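/- Let l ≥ 3, Δ ≥ 3 and n ≥ l + Δ − 2. Let G_a be the unicyclic graph on n vertices obtained from the cycle C_l by attaching Δ−3 pendant vertices and one end-vertex of a path on n−l−Δ+3 vertices to a single cycle vertex (which then has degree Δ). Then Kf(G_a) = (l³−l)/12 + (n−l−Δ+5)(n−l−Δ+4)(n−l+2Δ−6)/6 + (n−l)(l²−1)/6 + (Δ−2)(l−1) + (Δ−3)(Δ−4) + (l−1)(n−l−Δ+2)(n−l−Δ+5)/2. -/

import Mathlib

open scoped Classical

noncomputable section

namespace KfPaper

variable {V : Type*} {W : Type*}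

/-- The energy of a potential `f` on graph `G`, viewing each edge as a unit resistor:
`(1/2) · ∑_{x,y adjacent} (f x - f y)²` (each edge counted twice, hence the `1/2`). -/
def energy [Fintype V] (G : SimpleGraph V) (f : V → ℝ) : ℝ :=
  (1 / 2) * ∑ x : V, ∑ y : V, (if G.Adj x y then (f x - f y) ^ 2 else 0)

/-- The resistance distance (effective resistance) between `u` and `v`:
`r(u,v) = 1 / inf { energy f : f u = 1, f v = 0 }` and `r(u,u) = 0`. -/
def resistanceDistance [Fintype V] (G : SimpleGraph V) (u v : V) : ℝ :=
  if u = v then 0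
  else 1 / sInf {e : ℝ | ∃ f : V → ℝ, f u = 1 ∧ f v = 0 ∧ energy G f = e}

/-- The Kirchhoff index: sum of resistance distances over unordered pairs of distinct
vertices (each ordered pair counted once via the factor `1/2`, diagonal terms vanish). -/
def kirchhoffIndex [Fintype V] (G : SimpleGraph V) : ℝ :=
  (1 / 2) * ∑ u : V, ∑ v : V, resistanceDistance G u v

/-- `Kf_v(G) = ∑_{u ≠ v} r(v,u)` (the term `u = v` contributes `0`). -/
def kirchhoffAt [Fintype V] (G : SimpleGraph V) (v : V) : ℝ :=
  ∑ u : V, resistanceDistance G v u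

/-- The Wiener index: sum of graph distances over unordered pairs of distinct vertices. -/
def wienerIndex [Fintype V] (G : SimpleGraph V) : ℝ :=
  (1 / 2) * ∑ u : V, ∑ v : V, (G.dist u v : ℝ)

/-- `W_v(G) = ∑_u d(v,u)`. -/
def wienerAt [Fintype V] (G : SimpleGraph V) (v : V) : ℝ :=
  ∑ u : V, (G.dist v u : ℝ)

/-- The degree of a vertex. -/
def degree' (G : SimpleGraph V) (v : V) : ℕ := Nat.card (G.neighborSet v)

/-- `G` has maximum degree `Δ`. -/
def HasMaxDegree (G : SimpleGraph V) (Δ : ℕ) : Prop :=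
  (∀ v, degree' G v ≤ Δ) ∧ ∃ v, degree' G v = Δ

/-- A unicyclic graph: a connected graph containing exactly one cycle, equivalently a
connected graph with as many edges as vertices. -/
def IsUnicyclic [Fintype V] (G : SimpleGraph V) : Prop :=
  G.Connected ∧ Nat.card G.edgeSet = Fintype.card V

/-- `G_a`: the unicyclic graph on `Fin n` with the cycle `0,…,l−1`, with `Δ−3` pendant
vertices `l,…,l+Δ−4` attached to the cycle vertex `0`, and one end-vertex of the path
`l+Δ−3,…,n−1` (on `n−l−Δ+3` vertices) attached to `0` (so `0` has degree `Δ`). -/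
def Ga (n l Δ : ℕ) : SimpleGraph (Fin n) :=
  SimpleGraph.fromRel (fun i j =>
    (i.val + 1 = j.val ∧ j.val ≤ l - 1) ∨
    (i.val = 0 ∧ j.val = l - 1) ∨
    (i.val = 0 ∧ l ≤ j.val ∧ j.val ≤ l + Δ - 3) ∨
    (l + Δ - 3 ≤ i.val ∧ i.val + 1 = j.val))

/-- The symmetric bilinear form polarizing `energy`. -/
def energyForm [Fintype V] (G : SimpleGraph V) (f g : V → ℝ) : ℝ :=
  (1 / 2) * ∑ x : V, ∑ y : V, (if G.Adj x y then (f x - f y) * (g x - g y) else 0)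

lemma energyForm_self [Fintype V] (G : SimpleGraph V) (f : V → ℝ) :
    energyForm G f f = energy G f := by
  simp only [energyForm, energy, sq]

lemma energyForm_comm [Fintype V] (G : SimpleGraph V) (f g : V → ℝ) :
    energyForm G f g = energyForm G g f := by
  simp only [energyForm, mul_comm (f _ - f _)]

lemma energy_nonneg [Fintype V] (G : SimpleGraph V) (f : V → ℝ) : 0 ≤ energy G f := by
  unfold energy
  refine mul_nonneg (by norm_num) (Finset.sum_nonneg fun x _ => Finset.sum_nonneg fun y _ => ?_)
  split_ifs <;> positivity

lemma energyForm_comb [Fintype V] (G : SimpleGraph V) (f g h : V → ℝ) (a b : ℝ) :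
    energyForm G f (fun x => a * g x + b * h x)
      = a * energyForm G f g + b * energyForm G f h := by
  simp only [energyForm, Finset.mul_sum, ← Finset.sum_add_distrib]
  refine Finset.sum_congr rfl fun x _ => Finset.sum_congr rfl fun y _ => ?_
  split_ifs <;> ring

lemma energy_add_mul [Fintype V] (G : SimpleGraph V) (f g : V → ℝ) (t : ℝ) :
    energy G (fun x => f x + t * g x)
      = energy G f + 2 * t * energyForm G f g + t ^ 2 * energy G g := by
  simp only [energyForm, energy, Finset.mul_sum, ← Finset.sum_add_distrib]
  refine Finset.sum_congr rfl fun x _ => Finset.sum_congr rfl fun y _ => ?_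
  split_ifs <;> ring

/-- A potential carrying a unit current from `u` to `v` computes the resistance distance. -/
lemma resistanceDistance_eq_of_unit_current [Fintype V] (G : SimpleGraph V) {u v : V}
    (huv : u ≠ v) (g : V → ℝ) (hg : ∀ f : V → ℝ, energyForm G f g = f u - f v) :
    resistanceDistance G u v = g u - g v := by
  have hE : energy G g = g u - g v := by rw [← energyForm_self, hg]
  set R := g u - g v with hR
  have hR0 : 0 ≤ R := hE ▸ energy_nonneg G g
  have hRpos : 0 < R := by
    refine lt_of_le_of_ne hR0 fun h0 => ?_
    have h1 := hg (fun x => if x = u then 1 else 0)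
    have h2 := energy_add_mul G g (fun x => if x = u then (1 : ℝ) else 0)
    set e := energy G (fun x => if x = u then (1 : ℝ) else 0) with he
    have he0 : 0 ≤ e := energy_nonneg G _
    have hsymm : energyForm G g (fun x => if x = u then (1 : ℝ) else 0) = 1 := by
      rw [if_pos rfl, if_neg huv.symm, sub_zero] at h1
      rw [energyForm_comm, h1]
    have h3 := energy_nonneg G (fun x => g x + (-1 / (e + 1)) * (if x = u then (1 : ℝ) else 0))
    rw [h2, hsymm, hE, ← h0] at h3
    have h4 : (0 : ℝ) + 2 * (-1 / (e + 1)) * 1 + (-1 / (e + 1)) ^ 2 * e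
        = -(e + 2) / (e + 1) ^ 2 := by
      field_simp
      ring
    rw [h4] at h3
    have h5 : -(e + 2) / (e + 1) ^ 2 < 0 := div_neg_of_neg_of_pos (by linarith) (by positivity)
    linarith
  have hleast : IsLeast {e : ℝ | ∃ f : V → ℝ, f u = 1 ∧ f v = 0 ∧ energy G f = e} (1 / R) := by
    constructor
    · refine ⟨fun x => -(g v / R) + 1 / R * g x, ?_, ?_, ?_⟩
      · field_simp
        linarith
      · field_simp
        ring
      · rw [energy_add_mul G (fun _ => -(g v / R)) g, hg, hE]
        have : energy G (fun _ => -(g v / R)) = 0 := by simp [energy]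
        rw [this]
        field_simp
        ring
    · rintro e ⟨f, hu, hv, rfl⟩
      have h1 := energy_nonneg G (fun x => f x + (-1 / R) * g x)
      rw [energy_add_mul, hg, hu, hv, hE] at h1
      have h2 : energy G f + 2 * (-1 / R) * (1 - 0) + (-1 / R) ^ 2 * R = energy G f - 1 / R := by
        field_simp
        ring
      linarith
  rw [resistanceDistance, if_neg huv, hleast.csInf_eq, one_div_one_div]

/-- A symmetric kernel vanishing on the diagonal whose Laplacian is `-2 δ_v` up to a term
independent of `v` is the resistance distance. -/
lemma resistanceDistance_eq_of_kernel [Fintype V] (G : SimpleGraph V) (R : V → V → ℝ)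
    (hsymm : ∀ u v, R u v = R v u) (hdiag : ∀ u, R u u = 0) (Φ : (V → ℝ) → ℝ)
    (hR : ∀ f v, energyForm G f (fun w => R w v) = Φ f - 2 * f v) (u v : V) :
    resistanceDistance G u v = R u v := by
  by_cases huv : u = v
  · subst huv
    simp [resistanceDistance, hdiag]
  · rw [resistanceDistance_eq_of_unit_current G huv
      (fun w => (1 / 2) * R w v + (-1 / 2) * R w u)]
    · rw [hdiag, hdiag, hsymm v u]
      ring
    · intro f
      rw [energyForm_comb, hR, hR]
      ring

/-- The parent of a vertex in the spanning tree of `G_a` rooted at `0` obtained by deleting the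
edge `{0, l - 1}`; here `m = l + Δ - 3` is the first vertex of the pendant path. -/
def parent (l m i : ℕ) : ℕ := if i < l ∨ m < i then i - 1 else 0

/-- The vertex `i ≠ 0` lies on the path from `v` to the root of the spanning tree. -/
def OnRootPath (l m v i : ℕ) : Prop :=
  1 ≤ i ∧ i ≤ v ∧ (v < l ∨ m ≤ i ∨ i = v)

/-- The depth of a vertex in the spanning tree. -/
def depth (l m v : ℕ) : ℤ := if v < l then v else if v < m then 1 else v - m + 1

/-- The distance between two vertices in the spanning tree. -/
def treeDist (l m u v : ℕ) : ℤ :=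
  if (u < l ∧ v < l) ∨ (m ≤ u ∧ m ≤ v) then |(u : ℤ) - v|
  else if u = v then 0 else depth l m u + depth l m v

/-- The position on the cycle of the projection of a vertex to the cycle. -/
def cyclePos (l v : ℕ) : ℕ := if v < l then v else 0

/-- The claimed resistance distance in `G_a`. -/
def resistanceKernel (l m u v : ℕ) : ℝ :=
  treeDist l m u v - ((cyclePos l u : ℝ) - cyclePos l v) ^ 2 / l

lemma treeDist_comm (l m u v : ℕ) : treeDist l m u v = treeDist l m v u := by
  unfold treeDist
  rw [abs_sub_comm, add_comm]
  congr 1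
  · simp only [and_comm]
  · simp only [eq_comm]

lemma treeDist_self (l m u : ℕ) : treeDist l m u u = 0 := by
  simp [treeDist]

lemma treeDist_sub_parent {l m : ℕ} (hl : 3 ≤ l) (hm : l ≤ m) {i : ℕ} (hi : 1 ≤ i) (v : ℕ) :
    treeDist l m i v - treeDist l m (parent l m i) v
      = 1 - 2 * (if OnRootPath l m v i then 1 else 0) := by
  unfold treeDist parent depth OnRootPath
  simp only [abs_eq_max_neg]
  split_ifs <;> omega

lemma parent_lt {l m i : ℕ} (hi : 1 ≤ i) : parent l m i < i := by
  unfold parent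
  split_ifs <;> omega

lemma onRootPath_iff {l m v : ℕ} (hl : 3 ≤ l) (hm : l ≤ m) (hv : 1 ≤ v) (i : ℕ) :
    OnRootPath l m v i ↔ i = v ∨ OnRootPath l m (parent l m v) i := by
  unfold OnRootPath parent
  split_ifs <;> omega

lemma sum_onRootPath {l m n : ℕ} (hl : 3 ≤ l) (hm : l ≤ m) (F : ℕ → ℝ) (v : ℕ) (hv : v < n) :
    ∑ i ∈ Finset.Ico 1 n, (F i - F (parent l m i)) * (if OnRootPath l m v i then 1 else 0)
      = F v - F 0 := by
  induction v using Nat.strong_induction_on with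
  | _ v ih =>
    rcases Nat.eq_zero_or_pos v with rfl | hpos
    · rw [sub_self]
      refine Finset.sum_eq_zero fun i _ => ?_
      rw [if_neg (by unfold OnRootPath; omega), mul_zero]
    · have hp := parent_lt (l := l) (m := m) hpos
      have hsplit : ∀ i ∈ Finset.Ico 1 n,
          (F i - F (parent l m i)) * (if OnRootPath l m v i then (1 : ℝ) else 0)
            = (if i = v then F i - F (parent l m i) else 0)
              + (F i - F (parent l m i)) *
                (if OnRootPath l m (parent l m v) i then 1 else 0) := by
        intro i _
        by_cases hiv : i = v
        · subst hiv
          rw [if_pos ((onRootPath_iff hl hm hpos i).2 (Or.inl rfl)), if_pos rfl,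
            if_neg (by unfold OnRootPath; omega)]
          ring
        · simp only [onRootPath_iff hl hm hpos i, hiv, false_or, if_false, zero_add]
      rw [Finset.sum_congr rfl hsplit, Finset.sum_add_distrib, ih _ hp (hp.trans hv),
        Finset.sum_ite_eq', if_pos (Finset.mem_Ico.2 ⟨hpos, hv⟩)]
      ring

lemma Ga_adj_iff {n l Δ : ℕ} (hl : 3 ≤ l) (hΔ : 3 ≤ Δ) (x y : Fin n) :
    (Ga n l Δ).Adj x y ↔
      (1 ≤ x.val ∧ y.val = parent l (l + Δ - 3) x) ∨ (1 ≤ y.val ∧ x.val = parent l (l + Δ - 3) y) ∨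
      (x.val = 0 ∧ y.val = l - 1) ∨ (x.val = l - 1 ∧ y.val = 0) := by
  simp only [Ga, SimpleGraph.fromRel_adj, ne_eq, Fin.ext_iff, parent]
  split_ifs <;> omega

/-- The energy form of `G_a` as a sum over its edges. -/
lemma energyForm_Ga {n l Δ : ℕ} (hl : 3 ≤ l) (hΔ : 3 ≤ Δ) (hn : l + Δ - 2 ≤ n) (F H : ℕ → ℝ) :
    energyForm (Ga n l Δ) (fun x => F x) (fun x => H x)
      = ∑ i ∈ Finset.Ico 1 n, (F i - F (parent l (l + Δ - 3) i)) * (H i - H (parent l (l + Δ - 3) i))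
        + (F 0 - F (l - 1)) * (H 0 - H (l - 1)) := by
  set p := parent l (l + Δ - 3) with hp
  have hterm : ∀ x y : Fin n,
      (if (Ga n l Δ).Adj x y then (F x - F y) * (H x - H y) else 0)
        = (if y.val = p x then (if 1 ≤ x.val then (F x - F y) * (H x - H y) else 0) else 0)
          + (if x.val = p y then (if 1 ≤ y.val then (F x - F y) * (H x - H y) else 0) else 0)
          + (if y.val = l - 1 then (if x.val = 0 then (F x - F y) * (H x - H y) else 0) else 0)
          + (if x.val = l - 1 then (if y.val = 0 then (F x - F y) * (H x - H y) else 0) else 0) := by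
    intro x y
    have h1 : 1 ≤ x.val → p x < x := parent_lt
    have h2 : 1 ≤ y.val → p y < y := parent_lt
    have h3 : p (l - 1) = l - 2 := by rw [hp, parent, if_pos (by omega)]; omega
    have h4 : x.val = l - 1 → p x = l - 2 := fun h => h ▸ h3
    have h5 : y.val = l - 1 → p y = l - 2 := fun h => h ▸ h3
    simp only [Ga_adj_iff hl hΔ, ← hp]
    clear_value p
    split_ifs <;> first | omega | simp
  have hpn : ∀ x, x < n → p x < n := by
    intro x hx
    rw [hp]
    unfold parent
    split_ifs <;> omega
  have hA : ∑ x ∈ Finset.range n, ∑ y ∈ Finset.range n,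
      (if y = p x then (if 1 ≤ x then (F x - F y) * (H x - H y) else 0) else 0)
        = ∑ i ∈ Finset.Ico 1 n, (F i - F (p i)) * (H i - H (p i)) := by
    rw [show Finset.Ico 1 n = (Finset.range n).filter (fun x => 1 ≤ x) by ext; simp; omega,
      Finset.sum_filter]
    refine Finset.sum_congr rfl fun x hx => ?_
    rw [Finset.sum_ite_eq', if_pos (Finset.mem_range.2 (hpn x (Finset.mem_range.1 hx)))]
  have hB : ∑ x ∈ Finset.range n, ∑ y ∈ Finset.range n,
      (if y = l - 1 then (if x = 0 then (F x - F y) * (H x - H y) else 0) else 0)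
        = (F 0 - F (l - 1)) * (H 0 - H (l - 1)) := by
    have : ∀ x ∈ Finset.range n, ∑ y ∈ Finset.range n,
        (if y = l - 1 then (if x = 0 then (F x - F y) * (H x - H y) else 0) else 0)
          = if x = 0 then (F x - F (l - 1)) * (H x - H (l - 1)) else 0 := fun x _ => by
      rw [Finset.sum_ite_eq', if_pos (Finset.mem_range.2 (by omega))]
    rw [Finset.sum_congr rfl this, Finset.sum_ite_eq', if_pos (Finset.mem_range.2 (by omega))]
  have hneg : ∀ x y, (F x - F y) * (H x - H y) = (F y - F x) * (H y - H x) := fun x y => by ring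
  simp only [Finset.sum_range] at hA hB
  have hA' : ∑ x : Fin n, ∑ y : Fin n,
      (if x.val = p y then (if 1 ≤ y.val then (F x - F y) * (H x - H y) else 0) else 0)
        = ∑ i ∈ Finset.Ico 1 n, (F i - F (p i)) * (H i - H (p i)) := by
    rw [← hA, Finset.sum_comm]
    refine Finset.sum_congr rfl fun x _ => Finset.sum_congr rfl fun y _ => ?_
    rw [hneg y x]
  have hB' : ∑ x : Fin n, ∑ y : Fin n,
      (if x.val = l - 1 then (if y.val = 0 then (F x - F y) * (H x - H y) else 0) else 0)
        = (F 0 - F (l - 1)) * (H 0 - H (l - 1)) := by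
    rw [← hB, Finset.sum_comm]
    refine Finset.sum_congr rfl fun x _ => Finset.sum_congr rfl fun y _ => ?_
    rw [hneg y x]
  simp only [energyForm, hterm, Finset.sum_add_distrib]
  rw [hA, hB, hA', hB']
  ring

lemma resistanceKernel_sub_parent {l m : ℕ} (hl : 3 ≤ l) (hm : l ≤ m) {i : ℕ} (hi : 1 ≤ i)
    (v : ℕ) :
    resistanceKernel l m i v - resistanceKernel l m (parent l m i) v
      = (1 - (2 * (i : ℝ) - 1) / l * (if OnRootPath l m (l - 1) i then 1 else 0))
        - 2 * (if OnRootPath l m v i then 1 else 0)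
        + 2 * cyclePos l v / l * (if OnRootPath l m (l - 1) i then 1 else 0) := by
  have h := congrArg (Int.cast : ℤ → ℝ) (treeDist_sub_parent hl hm hi v)
  push_cast at h
  have hc : ((cyclePos l i : ℝ) - cyclePos l v) ^ 2
      - ((cyclePos l (parent l m i) : ℝ) - cyclePos l v) ^ 2
        = (2 * (i : ℝ) - 1 - 2 * cyclePos l v)
          * (if OnRootPath l m (l - 1) i then 1 else 0) := by
    by_cases hil : i < l
    · rw [if_pos (by unfold OnRootPath; omega)]
      have h1 : cyclePos l i = i := if_pos hil
      have h2 : cyclePos l (parent l m i) = i - 1 := by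
        unfold cyclePos parent
        split_ifs <;> omega
      rw [h1, h2, Nat.cast_sub hi]
      push_cast
      ring
    · rw [if_neg (by unfold OnRootPath; omega)]
      have h1 : cyclePos l i = 0 := if_neg hil
      have h2 : cyclePos l (parent l m i) = 0 := by
        unfold cyclePos parent
        split_ifs <;> omega
      rw [h1, h2]
      ring
  unfold resistanceKernel
  rw [sub_sub_sub_comm, ← sub_div, h, hc]
  ring

lemma resistanceKernel_zero_sub {l m : ℕ} (hl : 3 ≤ l) (hm : l ≤ m) (v : ℕ) :
    resistanceKernel l m 0 v - resistanceKernel l m (l - 1) v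
      = -((l : ℝ) - 1) / l + 2 * cyclePos l v / l := by
  have h : treeDist l m 0 v - treeDist l m (l - 1) v = 2 * cyclePos l v - (l - 1) := by
    unfold treeDist depth cyclePos
    simp only [abs_eq_max_neg]
    split_ifs <;> omega
  have h' := congrArg (Int.cast : ℤ → ℝ) h
  push_cast at h'
  have hl0 : (l : ℝ) ≠ 0 := by positivity
  have h1 : cyclePos l 0 = 0 := if_pos (by omega)
  have h2 : cyclePos l (l - 1) = l - 1 := if_pos (by omega)
  unfold resistanceKernel
  rw [sub_sub_sub_comm, ← sub_div, h', h1, h2, Nat.cast_sub (by omega)]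
  field_simp
  push_cast
  ring

theorem resistanceDistance_Ga {n l Δ : ℕ} (hl : 3 ≤ l) (hΔ : 3 ≤ Δ) (hn : l + Δ - 2 ≤ n)
    (u v : Fin n) :
    resistanceDistance (Ga n l Δ) u v = resistanceKernel l (l + Δ - 3) u v := by
  have hm : l ≤ l + Δ - 3 := by omega
  let ext : (Fin n → ℝ) → ℕ → ℝ := fun f i => if h : i < n then f ⟨i, h⟩ else 0
  refine resistanceDistance_eq_of_kernel _
    (fun u v : Fin n => resistanceKernel l (l + Δ - 3) u v) ?_ ?_
    (fun f => ∑ i ∈ Finset.Ico 1 n, (ext f i - ext f (parent l (l + Δ - 3) i))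
        * (1 - (2 * (i : ℝ) - 1) / l * (if OnRootPath l (l + Δ - 3) (l - 1) i then 1 else 0))
      + 2 * ext f 0 - (ext f 0 - ext f (l - 1)) * (((l : ℝ) - 1) / l)) ?_ u v
  · intro u v
    simp only [resistanceKernel]
    rw [treeDist_comm]
    ring
  · intro u
    simp [resistanceKernel, treeDist_self]
  · intro f v
    have hf : f = fun x : Fin n => ext f x := by
      funext x
      simp [ext]
    have hfv : f v = ext f v := congrFun hf v
    rw [hfv]
    conv_lhs => rw [hf]
    set F := ext f
    rw [energyForm_Ga hl hΔ hn F (fun w => resistanceKernel l (l + Δ - 3) w v),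
      resistanceKernel_zero_sub hl hm]
    have h1 := sum_onRootPath hl hm F v v.isLt
    have h2 := sum_onRootPath (n := n) hl hm F (l - 1) (by omega)
    have h3 : ∀ i ∈ Finset.Ico 1 n, (F i - F (parent l (l + Δ - 3) i))
        * (resistanceKernel l (l + Δ - 3) i v
          - resistanceKernel l (l + Δ - 3) (parent l (l + Δ - 3) i) v)
        = (F i - F (parent l (l + Δ - 3) i))
        * (1 - (2 * (i : ℝ) - 1) / l * (if OnRootPath l (l + Δ - 3) (l - 1) i then 1 else 0))
        - 2 * ((F i - F (parent l (l + Δ - 3) i))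
          * (if OnRootPath l (l + Δ - 3) v i then 1 else 0))
        + 2 * cyclePos l v / l * ((F i - F (parent l (l + Δ - 3) i))
          * (if OnRootPath l (l + Δ - 3) (l - 1) i then 1 else 0)) := by
      intro i hi
      rw [resistanceKernel_sub_parent hl hm (Finset.mem_Ico.1 hi).1]
      ring
    rw [Finset.sum_congr rfl h3, Finset.sum_add_distrib, Finset.sum_sub_distrib,
      ← Finset.mul_sum, ← Finset.mul_sum, h1, h2]
    ring

lemma sum_range_add_symm (K : ℕ → ℕ → ℝ) (hK : ∀ u v, K u v = K v u) (a b : ℕ) :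
    ∑ u ∈ Finset.range (a + b), ∑ v ∈ Finset.range (a + b), K u v
      = ∑ u ∈ Finset.range a, ∑ v ∈ Finset.range a, K u v
        + 2 * ∑ u ∈ Finset.range a, ∑ v ∈ Finset.range b, K u (a + v)
        + ∑ u ∈ Finset.range b, ∑ v ∈ Finset.range b, K (a + u) (a + v) := by
  simp only [Finset.sum_range_add, Finset.sum_add_distrib]
  have h : ∑ u ∈ Finset.range b, ∑ v ∈ Finset.range a, K (a + u) v
      = ∑ u ∈ Finset.range a, ∑ v ∈ Finset.range b, K u (a + v) := by
    rw [Finset.sum_comm]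
    exact Finset.sum_congr rfl fun u _ => Finset.sum_congr rfl fun v _ => hK _ _
  rw [h]
  ring

lemma sum_range_id_real (a : ℕ) :
    ∑ u ∈ Finset.range a, (u : ℝ) = (a : ℝ) * (a - 1) / 2 := by
  induction a with
  | zero => simp
  | succ a ih =>
    rw [Finset.sum_range_succ, ih]
    push_cast
    ring

lemma sum_range_sq_real (a : ℕ) :
    ∑ u ∈ Finset.range a, (u : ℝ) ^ 2 = (a : ℝ) * (a - 1) * (2 * a - 1) / 6 := by
  induction a with
  | zero => simp
  | succ a ih =>
    rw [Finset.sum_range_succ, ih]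
    push_cast
    ring

lemma sum_sum_abs_sub (a : ℕ) :
    ∑ u ∈ Finset.range a, ∑ v ∈ Finset.range a, |(u : ℝ) - v| = ((a : ℝ) ^ 3 - a) / 3 := by
  induction a with
  | zero => simp
  | succ a ih =>
    rw [sum_range_add_symm _ (fun u v => abs_sub_comm _ _), ih]
    have : ∀ u ∈ Finset.range a, ∑ v ∈ Finset.range 1, |(u : ℝ) - (a + v : ℕ)| = a - u := by
      intro u hu
      have hua : (u : ℝ) ≤ a := by exact_mod_cast (Finset.mem_range.1 hu).le
      rw [Finset.sum_range_one, add_zero, abs_of_nonpos (by linarith)]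
      ring
    rw [Finset.sum_congr rfl this, Finset.sum_sub_distrib, sum_range_id_real]
    simp
    ring

lemma sum_sum_sub_sq (a : ℕ) :
    ∑ u ∈ Finset.range a, ∑ v ∈ Finset.range a, ((u : ℝ) - v) ^ 2
      = (a : ℝ) ^ 2 * (a ^ 2 - 1) / 6 := by
  simp only [sub_sq, Finset.sum_add_distrib, Finset.sum_sub_distrib, ← Finset.mul_sum,
    ← Finset.sum_mul, sum_range_id_real, sum_range_sq_real, Finset.sum_const, Finset.card_range,
    nsmul_eq_mul]
  ring

lemma sum_sum_ne (a : ℕ) :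
    ∑ u ∈ Finset.range a, ∑ v ∈ Finset.range a, (if u = v then (0 : ℝ) else 2)
      = 2 * a * (a - 1) := by
  have : ∀ u ∈ Finset.range a, ∑ v ∈ Finset.range a, (if u = v then (0 : ℝ) else 2)
      = 2 * (a - 1) := by
    intro u hu
    have h : ∀ v, (if u = v then (0 : ℝ) else 2) = 2 - if u = v then 2 else 0 := by
      intro v
      split_ifs <;> norm_num
    simp only [h, Finset.sum_sub_distrib, Finset.sum_ite_eq, if_pos hu, Finset.sum_const,
      Finset.card_range, nsmul_eq_mul]
    ring
  rw [Finset.sum_congr rfl this, Finset.sum_const, Finset.card_range, nsmul_eq_mul]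
  ring

/-- The total resistance between ordered pairs of vertices, for `k` pendant vertices and a
pendant path on `p` vertices. -/
lemma sum_sum_resistanceKernel (l k p : ℕ) (hl : 3 ≤ l) :
    ∑ u ∈ Finset.range (l + k + p), ∑ v ∈ Finset.range (l + k + p), resistanceKernel l (l + k) u v
      = (((l : ℝ) ^ 3 - l) / 3 - l * (l ^ 2 - 1) / 6)
        + 2 * (k * (l + l * (l - 1) / 2 - (l - 1) * (2 * l - 1) / 6))
        + 2 * k * (k - 1)
        + 2 * (p * (l * (l - 1) / 2 - (l - 1) * (2 * l - 1) / 6) + l * (p + p * (p - 1) / 2)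
          + k * (2 * p + p * (p - 1) / 2))
        + ((p : ℝ) ^ 3 - p) / 3 := by
  have hl0 : (l : ℝ) ≠ 0 := by positivity
  have hsymm : ∀ u v, resistanceKernel l (l + k) u v = resistanceKernel l (l + k) v u := by
    intro u v
    simp only [resistanceKernel]
    rw [treeDist_comm]
    ring
  have hCC : ∀ u ∈ Finset.range l, ∀ v ∈ Finset.range l,
      resistanceKernel l (l + k) u v = |(u : ℝ) - v| - ((u : ℝ) - v) ^ 2 / l := by
    intro u hu v hv
    rw [Finset.mem_range] at hu hv
    simp [resistanceKernel, treeDist, cyclePos, hu, hv]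
  have hCK : ∀ u ∈ Finset.range l, ∀ v ∈ Finset.range k,
      resistanceKernel l (l + k) u (l + v) = 1 + (u : ℝ) - (u : ℝ) ^ 2 / l := by
    intro u hu v hv
    rw [Finset.mem_range] at hu hv
    have h : treeDist l (l + k) u (l + v) = 1 + u := by
      unfold treeDist depth
      split_ifs <;> omega
    simp [resistanceKernel, h, cyclePos, hu]
  have hCP : ∀ u ∈ Finset.range l, ∀ v ∈ Finset.range p,
      resistanceKernel l (l + k) u (l + k + v) = (u : ℝ) - (u : ℝ) ^ 2 / l + (1 + (v : ℝ)) := by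
    intro u hu v hv
    rw [Finset.mem_range] at hu hv
    have h : treeDist l (l + k) u (l + k + v) = u + (1 + v) := by
      unfold treeDist depth
      split_ifs <;> omega
    have h' : cyclePos l (l + k + v) = 0 := if_neg (by omega)
    simp only [resistanceKernel, h, h']
    simp [cyclePos, hu]
    ring
  have hKK : ∀ u ∈ Finset.range k, ∀ v ∈ Finset.range k,
      resistanceKernel l (l + k) (l + u) (l + v) = if u = v then (0 : ℝ) else 2 := by
    intro u hu v hv
    rw [Finset.mem_range] at hu hv
    have h : treeDist l (l + k) (l + u) (l + v) = if u = v then 0 else 2 := by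
      unfold treeDist depth
      split_ifs <;> omega
    simp [resistanceKernel, h, cyclePos]
  have hKP : ∀ u ∈ Finset.range k, ∀ v ∈ Finset.range p,
      resistanceKernel l (l + k) (l + u) (l + k + v) = 2 + (v : ℝ) := by
    intro u hu v hv
    rw [Finset.mem_range] at hu hv
    have h : treeDist l (l + k) (l + u) (l + k + v) = 2 + v := by
      unfold treeDist depth
      split_ifs <;> omega
    have h' : cyclePos l (l + k + v) = 0 := if_neg (by omega)
    simp only [resistanceKernel, h, h']
    simp [cyclePos]
  have hPP : ∀ u ∈ Finset.range p, ∀ v ∈ Finset.range p,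
      resistanceKernel l (l + k) (l + k + u) (l + k + v) = |(u : ℝ) - v| := by
    intro u _ v _
    have h' : ∀ v, cyclePos l (l + k + v) = 0 := fun v => if_neg (by omega)
    simp [resistanceKernel, treeDist, h']
  have congr₂ : ∀ {a b : ℕ} {f g : ℕ → ℕ → ℝ},
      (∀ u ∈ Finset.range a, ∀ v ∈ Finset.range b, f u v = g u v) →
      ∑ u ∈ Finset.range a, ∑ v ∈ Finset.range b, f u v
        = ∑ u ∈ Finset.range a, ∑ v ∈ Finset.range b, g u v :=
    fun h => Finset.sum_congr rfl fun u hu => Finset.sum_congr rfl fun v hv => h u hu v hv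
  rw [sum_range_add_symm _ hsymm (l + k) p, sum_range_add_symm _ hsymm l k, Finset.sum_range_add,
    congr₂ hCC, congr₂ hCK, congr₂ hCP, congr₂ hKK, congr₂ hKP, congr₂ hPP, sum_sum_ne,
    sum_sum_abs_sub]
  simp only [Finset.sum_sub_distrib, Finset.sum_add_distrib, ← Finset.sum_div, sum_sum_abs_sub,
    sum_sum_sub_sq, sum_range_id_real, sum_range_sq_real, Finset.sum_const, Finset.card_range,
    nsmul_eq_mul, ← Finset.mul_sum]
  field_simp

/-- The closed formula for the Kirchhoff index of `G_a`. -/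
theorem statement16 (n l Δ : ℕ) (hl : 3 ≤ l) (hΔ : 3 ≤ Δ) (hn : l + Δ - 2 ≤ n) :
    kirchhoffIndex (Ga n l Δ)
      = ((l : ℝ) ^ 3 - (l : ℝ)) / 12
        + ((n : ℝ) - l - Δ + 5) * ((n : ℝ) - l - Δ + 4) * ((n : ℝ) - l + 2 * Δ - 6) / 6
        + ((n : ℝ) - l) * ((l : ℝ) ^ 2 - 1) / 6
        + ((Δ : ℝ) - 2) * ((l : ℝ) - 1)
        + ((Δ : ℝ) - 3) * ((Δ : ℝ) - 4)
        + ((l : ℝ) - 1) * ((n : ℝ) - l - Δ + 2) * ((n : ℝ) - l - Δ + 5) / 2 := by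
  obtain ⟨k, rfl⟩ : ∃ k, Δ = k + 3 := ⟨Δ - 3, by omega⟩
  obtain ⟨p, rfl⟩ : ∃ p, n = l + k + p := ⟨n - (l + k), by omega⟩
  have hsum := sum_sum_resistanceKernel l k p hl
  simp only [Finset.sum_range] at hsum
  simp only [kirchhoffIndex, resistanceDistance_Ga hl hΔ hn]
  rw [show l + (k + 3) - 3 = l + k by omega, hsum]
  push_cast
  ring

end KfPaper
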